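/- arXiv:2011.09385 — 2 statements merged into one kernel-verified Lean document; each statement's English description precedes it below -/
import Mathlib

section
/- Let G be the pinwheel graph formed by joining p cycles of length k at a single common vertex, and let B be its non-backtracking matrix (a 2pk × 2pk matrix). Then the spectrum of B consists exactly of: each k-th root of unity with multiplicity p; each primitive-type root e^{2πij/(2k)} for odd j (1 ≤ j ≤ 2k−1) with multiplicity p−1; and each of the k complex k-th roots of 2p−1 with multiplicity 1. In particular the spectral radius of B is (2p−1)^{1/k}. -/
open Matrix Polynomial

/-- The non-backtracking matrix of a simple graph, indexed by darts. -/
def nbMatrix {V : Type*} [Fintype V] [DecidableEq V] (G : SimpleGraph V)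
    [DecidableRel G.Adj] : Matrix G.Dart G.Dart ℂ :=
  Matrix.of fun d e => if d.toProd.2 = e.toProd.1 ∧ d.toProd.1 ≠ e.toProd.2 then 1 else 0

/-- The pinwheel graph: `p` cycles of length `k`, all identified at a single common center
vertex.  Cycle `a` consists of the center together with the path
`(a,0), (a,1), …, (a,k-2)`, the center being adjacent to `(a,0)` and `(a,k-2)`. -/
def pinwheel (p k : ℕ) : SimpleGraph (Unit ⊕ Fin p × Fin (k - 1)) :=
  SimpleGraph.fromRel fun x y =>
    match x, y with
    | Sum.inl _, Sum.inr (_, i) => i.val = 0 ∨ i.val = k - 2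
    | Sum.inr (a, i), Sum.inr (b, j) => a = b ∧ i.val + 1 = j.val
    | _, _ => False

section CyclicBlocks

variable {R n : Type*} [CommRing R] [DecidableEq n]

/-- The block shift on `m` copies of `n`: the identity on the first block superdiagonal. -/
def blockShift (R n : Type*) [CommRing R] [DecidableEq n] (m : ℕ) :
    Matrix (n × Fin m) (n × Fin m) R :=
  of fun x y => if x.1 = y.1 ∧ x.2.val + 1 = y.2.val then 1 else 0

/-- The matrix on `m + 1` cyclically arranged copies of `n` which maps each copy identically to
the next one, and the last copy to the first one by `M`. -/
def cyclicBlock (m : ℕ) (M : Matrix n n R) : Matrix (n × Fin m ⊕ n) (n × Fin m ⊕ n) R :=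
  fromBlocks (blockShift R n m)
    (of fun x v => if x.1 = v ∧ x.2.val + 1 = m then 1 else 0)
    (of fun u y => if y.2.val = 0 then M u y.1 else 0) 0

variable [Fintype n]

theorem charpoly_blockShift (m : ℕ) :
    (blockShift R n m).charpoly = X ^ (Fintype.card n * m) := by
  have hN : (charmatrix (blockShift R n m)).BlockTriangular Prod.snd := by
    rw [charmatrix_blockTriangular_iff]
    intro x y hxy
    have : ¬ (x.1 = y.1 ∧ x.2.val + 1 = y.2.val) := by
      rintro ⟨-, h⟩
      have : y.2.val < x.2.val := hxy
      omega
    simp [blockShift, this]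
  have hblock (k : Fin m) :
      ((charmatrix (blockShift R n m)).toSquareBlock Prod.snd k).det = X ^ Fintype.card n := by
    have : (charmatrix (blockShift R n m)).toSquareBlock Prod.snd k
        = diagonal fun _ => X := by
      ext1 ⟨x, hx⟩ ⟨y, hy⟩
      have : ¬ (x.1 = y.1 ∧ x.2.val + 1 = y.2.val) := by
        rintro ⟨-, h⟩
        rw [hx, hy] at h
        omega
      simp [toSquareBlock_def, charmatrix_apply, blockShift, this, diagonal_apply]
    rw [this, det_diagonal, Finset.prod_const, Finset.card_univ]
    congr 1
    exact Fintype.card_congr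
      ⟨fun x => x.1.1, fun u => ⟨(u, k), rfl⟩, fun ⟨x, hx⟩ => by subst hx; rfl, fun _ => rfl⟩
  rw [charpoly, hN.det_fintype, Finset.prod_congr rfl fun k _ => hblock k, Finset.prod_const,
    Finset.card_univ, Fintype.card_fin, pow_mul]

theorem charpoly_cyclicBlock [IsDomain R] (m : ℕ) (hm : 0 < m) (M : Matrix n n R) :
    (cyclicBlock m M).charpoly = M.charpoly.comp (X ^ (m + 1)) := by
  let W : Matrix (n × Fin m) n R[X] := of fun x v => if x.1 = v then X ^ x.2.val else 0
  let V : Matrix (n × Fin m ⊕ n) (n × Fin m ⊕ n) R[X] :=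
    fromBlocks 1 W 0 (scalar n (X ^ m))
  have hV : V.det = X ^ (Fintype.card n * m) := by
    simp [V, det_fromBlocks_zero₂₁, ← pow_mul, mul_comm]
  have hmul : charmatrix (cyclicBlock m M) * V =
      fromBlocks (charmatrix (blockShift R n m)) 0
        (-(of fun u y => if y.2.val = 0 then M u y.1 else 0 :
          Matrix n (n × Fin m) R).map C)
        (scalar n (X ^ (m + 1)) - M.map C) := by
    rw [cyclicBlock, charmatrix_fromBlocks, fromBlocks_multiply]
    congr 1
    · simp
    · ext1 ⟨u, i⟩ v
      have hsum : (∑ x : n × Fin m,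
          C (blockShift R n m (u, i) x) * W x v) =
          if u = v ∧ i.val + 1 < m then X ^ (i.val + 1) else 0 := by
        split_ifs with h
        · rw [Finset.sum_eq_single (v, ⟨i.val + 1, h.2⟩)]
          · simp [blockShift, W, h.1]
          · rintro ⟨w, j⟩ - hne
            by_cases hw : u = w ∧ i.val + 1 = j.val
            · exact absurd (by ext1; exacts [hw.1.symm.trans h.1, Fin.ext hw.2.symm]) hne
            · simp [blockShift, hw]
          · simp
        · refine Finset.sum_eq_zero ?_
          rintro ⟨w, j⟩ -
          have := j.isLt
          by_cases hw : u = w ∧ i.val + 1 = j.val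
          · have : w ≠ v := fun h' => h ⟨hw.1.trans h', by omega⟩
            simp [W, this]
          · simp [blockShift, hw]
      have hi := i.isLt
      rw [Matrix.add_apply, charmatrix, Matrix.sub_mul, Matrix.sub_apply,
        Matrix.mul_apply (M := (RingHom.mapMatrix _) _)]
      simp only [RingHom.mapMatrix_apply, Matrix.map_apply, hsum]
      by_cases huv : u = v
      · subst huv
        rcases Nat.lt_or_ge (i.val + 1) m with h | h
        · simp [W, h, h.ne, pow_succ']
        · have h' : i.val + 1 = m := by omega
          simp [W, h', ← pow_succ']
      · simp [W, huv]
    · simp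
    · ext1 u v
      have hsum : (∑ x : n × Fin m,
          C (if x.2.val = 0 then M u x.1 else 0) * W x v) = C (M u v) := by
        rw [Finset.sum_eq_single (v, ⟨0, hm⟩)]
        · simp [W]
        · rintro ⟨w, j⟩ - hne
          by_cases hj : j.val = 0
          · have : w ≠ v := by
              rintro rfl
              exact hne (by ext1; exacts [rfl, Fin.ext hj])
            simp [W, this]
          · simp [hj]
        · simp
      simp [Matrix.mul_apply, hsum, sub_eq_neg_add, diagonal_apply, pow_succ', Matrix.neg_apply]
  have hdet := congrArg det hmul
  rw [det_mul, hV, det_fromBlocks_zero₁₂] at hdet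
  have hX : (X : R[X]) ^ (Fintype.card n * m) ≠ 0 := pow_ne_zero _ X_ne_zero
  have hcomp : (scalar n (X ^ (m + 1)) - M.map C).det = M.charpoly.comp (X ^ (m + 1)) := by
    rw [charpoly, ← coe_compRingHom_apply, RingHom.map_det]
    congr 1
    ext1 u v
    by_cases h : u = v <;> simp [h]
  rw [hcomp] at hdet
  change (cyclicBlock m M).charpoly * _ = (blockShift R n m).charpoly * _ at hdet
  rw [charpoly_blockShift, mul_comm] at hdet
  exact mul_left_cancel₀ hX hdet

end CyclicBlocks

/-- The transition matrix between the oriented cycles of a pinwheel: every oriented cycle can be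
followed by every oriented cycle except its own reverse. -/
def cycleTransition (p : ℕ) : Matrix (Fin p ⊕ Fin p) (Fin p ⊕ Fin p) ℂ :=
  of fun x y => if y = x.swap then 0 else 1

theorem charpoly_cycleTransition (p : ℕ) (hp : 1 ≤ p) :
    (cycleTransition p).charpoly =
      (X - 1) ^ p * (X + 1) ^ (p - 1) * (X - C (2 * p - 1 : ℂ)) := by
  let J : Matrix (Fin p) (Fin p) ℂ := vecMulVec 1 1
  have hM : cycleTransition p = fromBlocks J (J - 1) (J - 1) J := by
    ext (i | i) (j | j) <;>
      simp [cycleTransition, J, Matrix.one_apply, eq_comm] <;> split_ifs <;> simp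
  let K : Matrix (Fin p) (Fin p) ℂ := vecMulVec 2 1
  have hdet : (cycleTransition p).charpoly
      = K.charpoly.comp (X + 1) * (X - 1) ^ p := by
    have hC : (C 2 : ℂ[X]) = 2 := map_ofNat C 2
    have hfac : fromBlocks 1 0 (-1) 1 * charmatrix (cycleTransition p) * fromBlocks 1 0 1 1
        = fromBlocks ((compRingHom (X + 1)).mapMatrix (charmatrix K)) (-(J - 1).map C) 0
            (scalar (Fin p) (X - 1)) := by
      rw [hM, charmatrix_fromBlocks, fromBlocks_multiply, fromBlocks_multiply]
      congr 1 <;> ext1 i j <;> by_cases h : i = j <;>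
        simp [J, K, h, hC] <;> ring
    have := congrArg det hfac
    rw [det_mul, det_mul, det_fromBlocks_zero₁₂, det_fromBlocks_zero₁₂,
      det_fromBlocks_zero₂₁, ← RingHom.map_det] at this
    simpa [charpoly] using this
  obtain ⟨q, rfl⟩ := Nat.exists_eq_add_of_le' hp
  rw [hdet, charpoly_vecMulVec]
  simp [dotProduct, smul_eq_C_mul]
  ring

section PinwheelDarts

variable {p m : ℕ}

/-- The `i`-th vertex on cycle `a` of the pinwheel, for `0 ≤ i ≤ m + 1`; the center is both the
first and the last one. -/
def cycleVertex (a : Fin p) (i : ℕ) : Unit ⊕ Fin p × Fin (m + 1 - 1) :=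
  if h : 1 ≤ i ∧ i ≤ m then Sum.inr (a, ⟨i - 1, by omega⟩) else Sum.inl ()

theorem cycleVertex_eq_iff {a b : Fin p} {i j : ℕ} (hi : i ≤ m + 1) (hj : j ≤ m + 1) :
    (cycleVertex a i : Unit ⊕ Fin p × Fin (m + 1 - 1)) = cycleVertex b j ↔
      (a = b ∧ i = j) ∨ ((i = 0 ∨ i = m + 1) ∧ (j = 0 ∨ j = m + 1)) := by
  unfold cycleVertex
  split_ifs <;> simp <;> omega

/-- The `i`-th vertex on an oriented cycle of the pinwheel: `Sum.inl a` is cycle `a` traversed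
forwards and `Sum.inr a` is cycle `a` traversed backwards. -/
def orientedVertex : Fin p ⊕ Fin p → ℕ → Unit ⊕ Fin p × Fin (m + 1 - 1)
  | Sum.inl a, i => cycleVertex a i
  | Sum.inr a, i => cycleVertex a (m + 1 - i)

theorem adj_cycleVertex (hm : 1 ≤ m) (a : Fin p) {i : ℕ} (hi : i ≤ m) :
    (pinwheel p (m + 1)).Adj (cycleVertex a i) (cycleVertex a (i + 1)) := by
  rw [pinwheel, SimpleGraph.fromRel_adj, Ne, cycleVertex_eq_iff (by omega) (by omega)]
  refine ⟨by omega, ?_⟩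
  unfold cycleVertex
  split_ifs <;> simp <;> omega

theorem adj_orientedVertex (hm : 1 ≤ m) (x : Fin p ⊕ Fin p) {i : ℕ} (hi : i ≤ m) :
    (pinwheel p (m + 1)).Adj (orientedVertex x i) (orientedVertex x (i + 1)) := by
  rcases x with a | a
  · exact adj_cycleVertex hm a hi
  · have h := adj_cycleVertex hm a (Nat.sub_le m i)
    rw [show m - i + 1 = m + 1 - i by omega] at h
    simpa [orientedVertex] using h.symm

theorem exists_orientedVertex_of_adj {u v : Unit ⊕ Fin p × Fin (m + 1 - 1)}
    (h : (pinwheel p (m + 1)).Adj u v) :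
    ∃ (x : Fin p ⊕ Fin p) (i : ℕ), i ≤ m ∧ orientedVertex x i = u ∧
      orientedVertex x (i + 1) = v := by
  suffices H : ∀ u v : Unit ⊕ Fin p × Fin (m + 1 - 1),
      (match u, v with
        | Sum.inl _, Sum.inr (_, i) => i.val = 0 ∨ i.val = m + 1 - 2
        | Sum.inr (a, i), Sum.inr (b, j) => a = b ∧ i.val + 1 = j.val
        | _, _ => False : Prop) →
      ∃ (a : Fin p) (i : ℕ), i ≤ m ∧ ((cycleVertex a i = u ∧ cycleVertex a (i + 1) = v) ∨
        (cycleVertex a i = v ∧ cycleVertex a (i + 1) = u)) by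
    have key : ∃ (a : Fin p) (i : ℕ), i ≤ m ∧
        ((cycleVertex a i = u ∧ cycleVertex a (i + 1) = v) ∨
        (cycleVertex a i = v ∧ cycleVertex a (i + 1) = u)) := by
      rw [pinwheel, SimpleGraph.fromRel_adj] at h
      rcases h.2 with h | h
      · exact H u v (by rcases u with u | ⟨a, i⟩ <;> rcases v with v | ⟨b, j⟩ <;> exact h)
      · obtain ⟨a, i, hi, h⟩ :=
          H v u (by rcases u with u | ⟨a, i⟩ <;> rcases v with v | ⟨b, j⟩ <;> exact h)
        exact ⟨a, i, hi, h.symm⟩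
    obtain ⟨a, i, hi, h | h⟩ := key
    · exact ⟨Sum.inl a, i, hi, h⟩
    · refine ⟨Sum.inr a, m - i, by omega, ?_, ?_⟩
      · rw [orientedVertex, show m + 1 - (m - i) = i + 1 by omega, h.2]
      · rw [orientedVertex, show m + 1 - (m - i + 1) = i by omega, h.1]
  rintro (u | ⟨a, i⟩) (v | ⟨b, j⟩) h
  · exact h.elim
  · have hj := j.isLt
    rcases h with h | h
    · exact ⟨b, 0, by omega, Or.inl ⟨by simp [cycleVertex], by
        rw [cycleVertex, dif_pos (by omega)]; simp [Fin.ext_iff, h]⟩⟩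
    · exact ⟨b, m, le_rfl, Or.inr ⟨by
        rw [cycleVertex, dif_pos (by omega)]; simp [Fin.ext_iff, h], by simp [cycleVertex]⟩⟩
  · exact h.elim
  · have hj := j.isLt
    obtain ⟨rfl, h⟩ := h
    exact ⟨a, j.val, by omega, Or.inl ⟨by
      rw [cycleVertex, dif_pos (by omega)]; simp [Fin.ext_iff]; omega, by
      rw [cycleVertex, dif_pos (by omega)]; simp⟩⟩

theorem orientedVertex_pair_injective (hm : 2 ≤ m) {x y : Fin p ⊕ Fin p} {i j : ℕ}
    (hi : i ≤ m) (hj : j ≤ m)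
    (h₁ : (orientedVertex x i : Unit ⊕ Fin p × Fin (m + 1 - 1)) = orientedVertex y j)
    (h₂ : (orientedVertex x (i + 1) : Unit ⊕ Fin p × Fin (m + 1 - 1)) =
      orientedVertex y (j + 1)) : x = y ∧ i = j := by
  rcases x with a | a <;> rcases y with b | b <;>
    simp only [orientedVertex] at h₁ h₂ <;>
    rw [cycleVertex_eq_iff (by omega) (by omega)] at h₁ h₂ <;>
    simp <;> omega

theorem orientedVertex_nonbacktracking_iff (hm : 2 ≤ m) {x y : Fin p ⊕ Fin p} {i j : ℕ}
    (hi : i ≤ m) (hj : j ≤ m) :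
    ((orientedVertex x (i + 1) : Unit ⊕ Fin p × Fin (m + 1 - 1)) = orientedVertex y j ∧
      (orientedVertex x i : Unit ⊕ Fin p × Fin (m + 1 - 1)) ≠ orientedVertex y (j + 1)) ↔
      (x = y ∧ i + 1 = j) ∨ (i = m ∧ j = 0 ∧ y ≠ x.swap) := by
  rcases x with a | a <;> rcases y with b | b <;>
    simp only [orientedVertex, Ne] <;>
    rw [cycleVertex_eq_iff (by omega) (by omega), cycleVertex_eq_iff (by omega) (by omega)] <;>
    simp <;> omega

/-- The oriented cycle of a dart of the pinwheel, and its place on that cycle. -/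
def dartPlace : (Fin p ⊕ Fin p) × Fin m ⊕ (Fin p ⊕ Fin p) → (Fin p ⊕ Fin p) × ℕ
  | Sum.inl (x, i) => (x, i.val)
  | Sum.inr x => (x, m)

theorem dartPlace_snd_le (d : (Fin p ⊕ Fin p) × Fin m ⊕ (Fin p ⊕ Fin p)) :
    (dartPlace d).2 ≤ m := by
  rcases d with ⟨x, i⟩ | x
  · exact i.isLt.le
  · exact le_rfl

theorem dartPlace_injective : Function.Injective (dartPlace (p := p) (m := m)) := by
  rintro (⟨x, i⟩ | x) (⟨y, j⟩ | y) h <;> simp [dartPlace] at h ⊢ <;>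
    grind

theorem exists_dartPlace_eq (x : Fin p ⊕ Fin p) {i : ℕ} (hi : i ≤ m) :
    ∃ d : (Fin p ⊕ Fin p) × Fin m ⊕ (Fin p ⊕ Fin p), dartPlace d = (x, i) := by
  rcases hi.lt_or_eq with h | rfl
  · exact ⟨Sum.inl (x, ⟨i, h⟩), rfl⟩
  · exact ⟨Sum.inr x, rfl⟩

/-- The darts of the pinwheel, enumerated along the oriented cycles. -/
noncomputable def pinwheelDartEquiv (hm : 2 ≤ m) :
    (Fin p ⊕ Fin p) × Fin m ⊕ (Fin p ⊕ Fin p) ≃ (pinwheel p (m + 1)).Dart :=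
  Equiv.ofBijective
    (fun d => ⟨(orientedVertex (dartPlace d).1 (dartPlace d).2,
      orientedVertex (dartPlace d).1 ((dartPlace d).2 + 1)),
      adj_orientedVertex (by omega) _ (dartPlace_snd_le d)⟩) (by
    constructor
    · intro d e h
      rw [SimpleGraph.Dart.ext_iff, Prod.ext_iff] at h
      exact dartPlace_injective (Prod.ext_iff.2 (orientedVertex_pair_injective hm
        (dartPlace_snd_le d) (dartPlace_snd_le e) h.1 h.2))
    · intro ⟨⟨u, v⟩, h⟩
      obtain ⟨x, i, hi, hu, hv⟩ := exists_orientedVertex_of_adj h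
      obtain ⟨d, hd⟩ := exists_dartPlace_eq x hi
      refine ⟨d, SimpleGraph.Dart.ext _ _ (Prod.ext ?_ ?_)⟩
      · simpa [hd] using hu
      · simpa [hd] using hv)

theorem reindex_nbMatrix_pinwheel [DecidableRel (pinwheel p (m + 1)).Adj] (hm : 2 ≤ m) :
    reindex (pinwheelDartEquiv hm).symm (pinwheelDartEquiv hm).symm
      (nbMatrix (pinwheel p (m + 1))) = cyclicBlock m (cycleTransition p) := by
  have key (d e : (Fin p ⊕ Fin p) × Fin m ⊕ (Fin p ⊕ Fin p)) :
      nbMatrix (pinwheel p (m + 1)) (pinwheelDartEquiv hm d) (pinwheelDartEquiv hm e) =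
        if ((dartPlace d).1 = (dartPlace e).1 ∧ (dartPlace d).2 + 1 = (dartPlace e).2) ∨
          ((dartPlace d).2 = m ∧ (dartPlace e).2 = 0 ∧ (dartPlace e).1 ≠ (dartPlace d).1.swap)
        then 1 else 0 :=
    if_congr (orientedVertex_nonbacktracking_iff hm (dartPlace_snd_le d) (dartPlace_snd_le e))
      rfl rfl
  have hm0 : m ≠ 0 := by omega
  ext1 d e
  rw [reindex_apply, submatrix_apply, Equiv.symm_symm, key]
  rcases d with ⟨x, i⟩ | x <;> rcases e with ⟨y, j⟩ | y
  · simp [dartPlace, cyclicBlock, blockShift, i.isLt.ne]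
  · simp [dartPlace, cyclicBlock, i.isLt.ne]
  · have hj : m + 1 ≠ j.val := by omega
    by_cases h : j.val = 0 <;> simp [dartPlace, cyclicBlock, cycleTransition, h, hj]
  · simp [dartPlace, cyclicBlock, hm0]

theorem charpoly_nbMatrix_pinwheel_succ [DecidableRel (pinwheel p (m + 1)).Adj] (hp : 1 ≤ p)
    (hm : 2 ≤ m) :
    (nbMatrix (pinwheel p (m + 1))).charpoly = (X ^ (m + 1) - 1) ^ p *
      (X ^ (m + 1) + 1) ^ (p - 1) * (X ^ (m + 1) - C (2 * p - 1 : ℂ)) := by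
  rw [← charpoly_reindex (pinwheelDartEquiv hm).symm, reindex_nbMatrix_pinwheel,
    charpoly_cyclicBlock m (by omega), charpoly_cycleTransition p hp]
  simp

end PinwheelDarts

/-- The non-backtracking spectrum of the pinwheel graph of `p ≥ 2` cycles of length `k ≥ 3`:
the characteristic polynomial is `(λ^k - 1)^p (λ^k + 1)^(p-1) (λ^k - (2p-1))`, so the
eigenvalues are the `k`-th roots of unity with multiplicity `p`, the numbers `e^{2πij/(2k)}`
for odd `j` with multiplicity `p-1`, and the `k` complex `k`-th roots of `2p-1` with
multiplicity `1`; in particular the spectral radius of `B` is `(2p-1)^{1/k}`. -/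
theorem charpoly_nbMatrix_pinwheel (p k : ℕ) (hp : 2 ≤ p) (hk : 3 ≤ k) :
    letI : DecidableRel (pinwheel p k).Adj := Classical.decRel _
    (nbMatrix (pinwheel p k)).charpoly
        = (X ^ k - 1) ^ p * (X ^ k + 1) ^ (p - 1) * (X ^ k - C (2 * p - 1 : ℂ)) ∧
      (∀ μ ∈ spectrum ℂ (nbMatrix (pinwheel p k)),
        ‖μ‖ ≤ (2 * (p : ℝ) - 1) ^ ((k : ℝ)⁻¹)) ∧
      (((2 * (p : ℝ) - 1) ^ ((k : ℝ)⁻¹) : ℝ) : ℂ) ∈ spectrum ℂ (nbMatrix (pinwheel p k)) := by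
  let : DecidableRel (pinwheel p k).Adj := Classical.decRel _
  have hchar : (nbMatrix (pinwheel p k)).charpoly
      = (X ^ k - 1) ^ p * (X ^ k + 1) ^ (p - 1) * (X ^ k - C (2 * p - 1 : ℂ)) := by
    obtain ⟨m, rfl⟩ := Nat.exists_eq_add_of_le' (show 1 ≤ k by omega)
    exact charpoly_nbMatrix_pinwheel_succ (by omega) (by omega)
  have hp' : (2 : ℝ) ≤ p := by exact_mod_cast hp
  have hk0 : k ≠ 0 := by omega
  have hnorm : ‖(2 * p - 1 : ℂ)‖ = 2 * (p : ℝ) - 1 := by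
    rw [show (2 * p - 1 : ℂ) = ((2 * (p : ℝ) - 1 : ℝ) : ℂ) by push_cast; rfl,
      Complex.norm_of_nonneg (by linarith)]
  refine ⟨hchar, fun μ hμ => ?_, ?_⟩
  · rw [mem_spectrum_iff_isRoot_charpoly, hchar, IsRoot.def] at hμ
    simp only [eval_mul, eval_pow, eval_sub, eval_add, eval_X, eval_one, eval_C,
      mul_eq_zero] at hμ
    have hpow : ‖μ‖ ^ k ≤ 2 * (p : ℝ) - 1 := by
      rw [← norm_pow]
      rcases hμ with (h | h) | h
      · rw [sub_eq_zero.1 (eq_zero_of_pow_eq_zero h), norm_one]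
        linarith
      · rw [eq_neg_of_add_eq_zero_left (eq_zero_of_pow_eq_zero h), norm_neg, norm_one]
        linarith
      · rw [sub_eq_zero.1 h, hnorm]
    rw [← Real.pow_rpow_inv_natCast (norm_nonneg μ) hk0]
    exact Real.rpow_le_rpow (by positivity) hpow (by positivity)
  · rw [mem_spectrum_iff_isRoot_charpoly, hchar, IsRoot.def]
    have h : (((2 * (p : ℝ) - 1) ^ ((k : ℝ)⁻¹) : ℝ) : ℂ) ^ k = 2 * p - 1 := by
      rw [← Complex.ofReal_pow, Real.rpow_inv_natCast_pow (by linarith) hk0]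
      push_cast
      rfl
    simp [h]
end

section
/- If G is a connected graph with minimum degree at least 2 that is neither a tree nor a cycle, then the spectral radius of K = [[A, D−I],[−I, 0]] (equivalently, of the non-backtracking matrix B) is strictly greater than 1. -/
open Matrix

/-- The matrix `K = [[A, D-I], [-I, 0]]`. -/
def Kmatrix {V : Type*} [Fintype V] [DecidableEq V] (G : SimpleGraph V)
    [DecidableRel G.Adj] : Matrix (V ⊕ V) (V ⊕ V) ℂ :=
  Matrix.fromBlocks (G.adjMatrix ℂ) (Matrix.diagonal (fun v => (G.degree v : ℂ)) - 1) (-1) 0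

/-- A connected finite graph all of whose vertices have degree two is a cycle graph. -/
theorem SimpleGraph.Connected.exists_iso_cycleGraph {V : Type*} [Fintype V]
    {G : SimpleGraph V} [DecidableRel G.Adj] (hconn : G.Connected)
    (hdeg : ∀ v, G.degree v = 2) :
    ∃ n : ℕ, Nonempty (G ≃g SimpleGraph.cycleGraph n) := by
  classical
  have hdegree : ∀ {n : ℕ}, 2 < n → ∀ i, (SimpleGraph.cycleGraph n).degree i = 2 := fun hn i => by
    obtain ⟨m, rfl⟩ := Nat.exists_eq_add_of_le' (Nat.succ_le_of_lt hn)
    exact SimpleGraph.cycleGraph_degree_three_le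
  obtain ⟨v⟩ := hconn.nonempty
  have hcycles : G.IsCycles := fun w _ => by
    rw [Set.ncard_eq_toFinset_card', ← SimpleGraph.neighborFinset_def,
      SimpleGraph.card_neighborFinset_eq_degree, hdeg]
  have hne : (G.neighborSet v).Nonempty := by
    obtain ⟨w, hw⟩ := (G.degree_pos_iff_exists_adj v).1 (by rw [hdeg]; norm_num)
    exact ⟨w, hw⟩
  obtain ⟨p, hp, hverts⟩ := hcycles.exists_cycle_toSubgraph_verts_eq_connectedComponentSupp
    (c := G.connectedComponentMk v) rfl hne
  have hlen : 2 < p.length := hp.three_le_length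
  obtain ⟨f⟩ := (SimpleGraph.cycleGraph_isContained_iff hlen).2 ⟨v, p, hp, rfl⟩
  have hmem : ∀ w, w ∈ p.support := fun w => by
    rw [← SimpleGraph.Walk.mem_verts_toSubgraph, hverts,
      SimpleGraph.ConnectedComponent.mem_supp_iff,
      SimpleGraph.ConnectedComponent.eq]
    exact hconn.preconnected w v
  have hcard : Fintype.card V ≤ p.length := by
    have htail : (Finset.univ : Finset V) ⊆ p.support.tail.toFinset := fun w _ => by
      rw [List.mem_toFinset]
      by_cases hw : w = v
      · exact hw ▸ SimpleGraph.Walk.end_mem_tail_support hp.not_nil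
      · exact ((SimpleGraph.Walk.mem_support_iff p).1 (hmem w)).resolve_left hw
    calc Fintype.card V ≤ p.support.tail.toFinset.card := Finset.card_le_card htail
      _ ≤ p.support.tail.length := List.toFinset_card_le _
      _ = p.length := by simp
  have hbij : Function.Bijective f := by
    rw [Fintype.bijective_iff_injective_and_card]
    refine ⟨f.injective, le_antisymm (Fintype.card_le_of_injective f f.injective) ?_⟩
    simpa using hcard
  refine ⟨p.length, ⟨RelIso.symm ⟨Equiv.ofBijective f hbij, @fun i j => ?_⟩⟩⟩
  refine ⟨fun h => ?_, fun h => f.toHom.map_adj h⟩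
  have hsub : ((SimpleGraph.cycleGraph p.length).neighborFinset i).map ⟨f, f.injective⟩ ⊆
      G.neighborFinset (f i) := fun w hw => by
    obtain ⟨k, hk, rfl⟩ := Finset.mem_map.1 hw
    rw [SimpleGraph.mem_neighborFinset] at hk ⊢
    exact f.toHom.map_adj hk
  have heq := Finset.eq_of_subset_of_card_le hsub (by
    rw [Finset.card_map, SimpleGraph.card_neighborFinset_eq_degree,
      SimpleGraph.card_neighborFinset_eq_degree, hdegree hlen, hdeg])
  have hj : f j ∈ G.neighborFinset (f i) := (SimpleGraph.mem_neighborFinset _ _ _).2 h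
  rw [← heq] at hj
  simpa using hj

/-- Along a continuous path of real symmetric matrices that starts at a positive definite matrix
and ends at one that is not, some matrix of the path is singular. -/
theorem Matrix.exists_mulVec_eq_zero_of_continuous {n : Type*} [Fintype n]
    {M : ℝ → Matrix n n ℝ} (hM : Continuous M) (hherm : ∀ s, (M s).IsHermitian)
    (h0 : ∀ x : n → ℝ, x ≠ 0 → 0 < x ⬝ᵥ M 0 *ᵥ x) {s₁ : ℝ} (hs₁ : 0 ≤ s₁) {x₁ : n → ℝ}
    (hx₁ : x₁ ≠ 0) (hq : x₁ ⬝ᵥ M s₁ *ᵥ x₁ ≤ 0) :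
    ∃ s, 0 < s ∧ s ≤ s₁ ∧ ∃ x : n → ℝ, x ≠ 0 ∧ M s *ᵥ x = 0 := by
  have hcont : Continuous fun z : ℝ × (n → ℝ) => z.2 ⬝ᵥ M z.1 *ᵥ z.2 :=
    continuous_snd.dotProduct ((hM.comp continuous_fst).matrix_mulVec continuous_snd)
  have hscale : ∀ s (c : ℝ) (x : n → ℝ),
      (c • x) ⬝ᵥ M s *ᵥ (c • x) = c ^ 2 * (x ⬝ᵥ M s *ᵥ x) := fun s c x => by
    rw [mulVec_smul, smul_dotProduct, dotProduct_smul, smul_eq_mul, smul_eq_mul]; ring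
  let S : Set (ℝ × (n → ℝ)) :=
    (Set.Icc 0 s₁ ×ˢ Metric.sphere 0 1) ∩ {z | z.2 ⬝ᵥ M z.1 *ᵥ z.2 ≤ 0}
  have hmem : ∀ s ∈ Set.Icc 0 s₁, ∀ x : n → ℝ, x ≠ 0 → x ⬝ᵥ M s *ᵥ x ≤ 0 →
      (s, ‖x‖⁻¹ • x) ∈ S := fun s hs x hx hle => by
    refine ⟨⟨hs, ?_⟩, ?_⟩
    · simp [norm_smul, hx]
    · rw [Set.mem_ofPred_eq, hscale]
      exact mul_nonpos_of_nonneg_of_nonpos (sq_nonneg _) hle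
  have hcpt : IsCompact S := (isCompact_Icc.prod (isCompact_sphere 0 1)).inter_right
    (isClosed_le hcont continuous_const)
  obtain ⟨⟨s, x⟩, ⟨⟨hs, hx⟩, hle⟩, hmin⟩ := hcpt.exists_isMinOn
    ⟨_, hmem s₁ ⟨hs₁, le_rfl⟩ x₁ hx₁ hq⟩ continuous_fst.continuousOn
  have hx0 : x ≠ 0 := by
    rintro rfl
    simp at hx
  have hspos : 0 < s := lt_of_le_of_ne hs.1 fun h => by
    subst h
    exact absurd hle (not_le.2 (h0 x hx0))
  have hnonneg : ∀ y : n → ℝ, 0 ≤ y ⬝ᵥ M s *ᵥ y := fun y => by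
    have hclosed : IsClosed {t : ℝ | 0 ≤ y ⬝ᵥ M t *ᵥ y} :=
      isClosed_le continuous_const (hcont.comp (continuous_id.prodMk continuous_const))
    have hsub : Set.Ico 0 s ⊆ {t : ℝ | 0 ≤ y ⬝ᵥ M t *ᵥ y} := fun t ht => by
      by_contra hneg
      rw [Set.mem_ofPred_eq, not_le] at hneg
      have hy : y ≠ 0 := by
        rintro rfl
        simp at hneg
      exact absurd (hmin (hmem t ⟨ht.1, ht.2.le.trans hs.2⟩ y hy hneg.le)) (not_le.2 ht.2)
    have hcl := hclosed.closure_subset_iff.2 hsub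
    rw [closure_Ico hspos.ne] at hcl
    exact hcl ⟨hspos.le, le_rfl⟩
  have hpsd : (M s).PosSemidef := .of_dotProduct_mulVec_nonneg (hherm s) (by simpa using hnonneg)
  refine ⟨s, hspos, hs.2, x, hx0, (hpsd.dotProduct_mulVec_zero_iff x).1 ?_⟩
  simpa using le_antisymm hle (hnonneg x)

/-- An eigenvalue outside the closed unit disc forces the spectral radius to exceed one. -/
theorem Matrix.one_lt_spectralRadius_of_mulVec_eq {n : Type*} [Fintype n] [DecidableEq n]
    {M : Matrix n n ℂ} {μ : ℂ} (hμ : 1 < ‖μ‖) {w : n → ℂ} (hw : w ≠ 0) (h : M *ᵥ w = μ • w) :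
    1 < spectralRadius ℂ M := by
  have hspec : μ ∈ spectrum ℂ M := by
    rw [← Matrix.spectrum_toLin']
    exact (Module.End.hasEigenvalue_of_hasEigenvector
      (Module.End.hasEigenvector_iff.2
        ⟨Module.End.mem_eigenspace_iff.2 (by simpa using h), hw⟩)).mem_spectrum
  refine lt_of_lt_of_le ?_ (le_iSup₂ (f := fun k _ => (‖k‖₊ : ENNReal)) μ hspec)
  exact_mod_cast hμ

/-- The quadratic pencil `I - sA + s²(D - I)` of the Ihara–Bass formula has a singular member
with `0 < s < 1`. -/
theorem SimpleGraph.exists_ihara_kernel {V : Type*} [Fintype V] [DecidableEq V]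
    (G : SimpleGraph V) [DecidableRel G.Adj] [Nonempty V]
    (hsum : 2 * Fintype.card V < ∑ v, G.degree v) :
    ∃ s : ℝ, 0 < s ∧ s < 1 ∧ ∃ x : V → ℝ, x ≠ 0 ∧
      ∀ v, x v - s * ∑ w ∈ G.neighborFinset v, x w + s ^ 2 * ((G.degree v - 1) * x v) = 0 := by
  set M : ℝ → Matrix V V ℝ := fun s =>
    1 - s • G.adjMatrix ℝ + s ^ 2 • Matrix.diagonal (fun v => (G.degree v : ℝ) - 1) with hM
  have hMx : ∀ s (x : V → ℝ) v, (M s *ᵥ x) v =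
      x v - s * ∑ w ∈ G.neighborFinset v, x w + s ^ 2 * ((G.degree v - 1) * x v) :=
    fun s x v => by
      simp [hM, Matrix.add_mulVec, Matrix.sub_mulVec, Matrix.smul_mulVec, Matrix.mulVec_diagonal,
        SimpleGraph.adjMatrix_mulVec_apply]
  set N : ℝ := (Fintype.card V : ℝ) with hN
  set T : ℝ := ∑ v, (G.degree v : ℝ) with hT
  have hNpos : 0 < N := by rw [hN]; exact_mod_cast Fintype.card_pos
  have hTN : 2 * N < T := by rw [hN, hT]; exact_mod_cast hsum
  have hquad : ∀ s, (1 : V → ℝ) ⬝ᵥ M s *ᵥ 1 = N - s * T + s ^ 2 * (T - N) := fun s => by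
    simp [dotProduct, hMx, Finset.sum_add_distrib, Finset.sum_sub_distrib, ← Finset.mul_sum,
      hN, hT]
  obtain ⟨s, hs, hs', x, hx, h⟩ := Matrix.exists_mulVec_eq_zero_of_continuous (M := M)
    (by fun_prop)
    (fun s => by
      refine (Matrix.isHermitian_one.sub ?_).add ?_
      · simp [Matrix.IsHermitian]
      · simp [Matrix.IsHermitian])
    (fun x hx => by simpa [hM] using Matrix.dotProduct_star_self_pos_iff.2 hx)
    (s₁ := N / (T - N)) (div_nonneg hNpos.le (by linarith)) (x₁ := 1) one_ne_zero
    (by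
      have : T - N ≠ 0 := by linarith
      rw [hquad]
      apply le_of_eq
      field_simp
      ring)
  refine ⟨s, hs, hs'.trans_lt ((div_lt_one (by linarith)).2 (by linarith)), x, hx, fun v => ?_⟩
  rw [← hMx, h, Pi.zero_apply]

/-- A kernel vector of `I - sA + s²(D - I)` lifts to an eigenvector of `K`. -/
theorem Kmatrix_mulVec_eq {V : Type*} [Fintype V] [DecidableEq V] (G : SimpleGraph V)
    [DecidableRel G.Adj] {s : ℂ} (hs : s ≠ 0) {x : V → ℂ}
    (h : ∀ v, x v - s * ∑ w ∈ G.neighborFinset v, x w + s ^ 2 * ((G.degree v - 1) * x v) = 0) :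
    Kmatrix G *ᵥ Sum.elim x (-(s • x)) = s⁻¹ • Sum.elim x (-(s • x)) := by
  rw [Kmatrix, Matrix.fromBlocks_mulVec]
  ext (v | v)
  · simp only [Sum.elim_inl, Sum.elim_comp_inl, Sum.elim_comp_inr, Pi.add_apply, Pi.smul_apply,
      SimpleGraph.adjMatrix_mulVec_apply, Matrix.sub_mulVec, Matrix.mulVec_diagonal,
      Matrix.one_mulVec, Pi.sub_apply, Pi.neg_apply, smul_eq_mul]
    field_simp
    linear_combination -h v
  · simp [Matrix.neg_mulVec, hs]

/-- A kernel vector of `I - sA + s²(D - I)` lifts to a solution of `B w = s⁻¹ w`. -/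
theorem nbMatrix_mulVec_eq {V : Type*} [Fintype V] [DecidableEq V] (G : SimpleGraph V)
    [DecidableRel G.Adj] {s : ℂ} (hs : s ≠ 0) {x : V → ℂ}
    (h : ∀ v, x v - s * ∑ w ∈ G.neighborFinset v, x w + s ^ 2 * ((G.degree v - 1) * x v) = 0) :
    nbMatrix G *ᵥ (fun d => s * x d.fst - x d.snd) =
      s⁻¹ • fun d : G.Dart => s * x d.fst - x d.snd := by
  ext ⟨⟨u, v⟩, huv⟩
  have hsum : (nbMatrix G *ᵥ (fun d => s * x d.fst - x d.snd)) ⟨⟨u, v⟩, huv⟩ =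
      ∑ w ∈ (G.neighborFinset v).erase u, (s * x v - x w) := by
    simp only [Matrix.mulVec, dotProduct, nbMatrix, Matrix.of_apply, ite_mul, one_mul, zero_mul]
    rw [← Finset.sum_filter]
    refine Finset.sum_bij' (fun d _ => d.snd)
      (fun w hw => ⟨(v, w), by simpa using (Finset.mem_erase.1 hw).2⟩) ?_ ?_ ?_ ?_ ?_
    · rintro ⟨⟨a, b⟩, hab⟩ hd
      simp only [Finset.mem_filter, Finset.mem_univ, true_and] at hd
      obtain ⟨rfl, hne⟩ := hd
      simpa using ⟨hne.symm, hab⟩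
    · intro w hw
      simpa using (Finset.mem_erase.1 hw).1.symm
    · rintro ⟨⟨a, b⟩, hab⟩ hd
      simp only [Finset.mem_filter, Finset.mem_univ, true_and] at hd
      obtain ⟨rfl, hne⟩ := hd
      rfl
    · intro w hw
      rfl
    · rintro ⟨⟨a, b⟩, hab⟩ hd
      simp only [Finset.mem_filter, Finset.mem_univ, true_and] at hd
      obtain ⟨rfl, hne⟩ := hd
      rfl
  have hu : u ∈ G.neighborFinset v := (SimpleGraph.mem_neighborFinset _ _ _).2 huv.symm
  rw [hsum, Finset.sum_erase_eq_sub hu, Finset.sum_sub_distrib, Finset.sum_const,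
    SimpleGraph.card_neighborFinset_eq_degree]
  simp only [Pi.smul_apply, smul_eq_mul, nsmul_eq_mul]
  field_simp
  linear_combination h v

/-- If `G` is a connected graph with minimum degree at least 2 that is neither a tree nor a
cycle, then the spectral radius of `K` (equivalently, of the non-backtracking matrix `B`)
is strictly greater than 1. -/
theorem one_lt_spectralRadius_Kmatrix {V : Type*} [Fintype V] [DecidableEq V]
    (G : SimpleGraph V) [DecidableRel G.Adj] (hconn : G.Connected)
    (hdeg : ∀ v : V, 2 ≤ G.degree v) (htree : ¬ G.IsTree)
    (hcyc : ¬ ∃ n : ℕ, Nonempty (G ≃g SimpleGraph.cycleGraph n)) :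
    1 < spectralRadius ℂ (Kmatrix G) ∧ 1 < spectralRadius ℂ (nbMatrix G) := by
  have := hconn.nonempty
  have hsum : 2 * Fintype.card V < ∑ v, G.degree v := by
    obtain ⟨v, hv⟩ : ∃ v, 2 < G.degree v := by
      by_contra! hle
      exact hcyc (hconn.exists_iso_cycleGraph fun v => le_antisymm (hle v) (hdeg v))
    calc 2 * Fintype.card V = ∑ _v : V, 2 := by simp [mul_comm]
      _ < ∑ v, G.degree v :=
        Finset.sum_lt_sum (fun v _ => hdeg v) ⟨v, Finset.mem_univ v, hv⟩
  obtain ⟨s, hs, hs1, x, hx, h⟩ := G.exists_ihara_kernel hsum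
  obtain ⟨v, hv⟩ := Function.ne_iff.1 hx
  have hvC : (x v : ℂ) ≠ 0 := by exact_mod_cast hv
  have hs0 : (s : ℂ) ≠ 0 := by exact_mod_cast hs.ne'
  have hC : ∀ v, (x v : ℂ) - s * ∑ w ∈ G.neighborFinset v, (x w : ℂ) +
      (s : ℂ) ^ 2 * ((G.degree v - 1) * x v) = 0 := fun v => by exact_mod_cast h v
  have hnorm : 1 < ‖(s : ℂ)⁻¹‖ := by
    rw [norm_inv, Complex.norm_real, Real.norm_of_nonneg hs.le]
    exact (one_lt_inv₀ hs).2 hs1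
  constructor
  · refine Matrix.one_lt_spectralRadius_of_mulVec_eq hnorm (fun h0 => hvC ?_)
      (Kmatrix_mulVec_eq G hs0 (x := fun v => (x v : ℂ)) hC)
    exact congrFun h0 (Sum.inl v)
  · refine Matrix.one_lt_spectralRadius_of_mulVec_eq hnorm (fun h0 => hv ?_)
      (nbMatrix_mulVec_eq G hs0 (x := fun v => (x v : ℂ)) hC)
    have hdart : ∀ a b, G.Adj a b → s * x a = x b := fun a b hab => by
      have := congrFun h0 ⟨(a, b), hab⟩
      exact_mod_cast sub_eq_zero.1 this
    obtain ⟨w, hw⟩ := (G.degree_pos_iff_exists_adj v).1 (by linarith [hdeg v])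
    have h1 := hdart v w hw
    have h2 := hdart w v hw.symm
    have h3 : (1 - s ^ 2) * x v = 0 := by rw [← h1] at h2; linear_combination -h2
    exact (mul_eq_zero.1 h3).resolve_left (by nlinarith)
end
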